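/- For every natural number d there exists a natural number N_d such that the following holds. Let K be a field of prime characteristic p > N_d with algebraic closure K̄, and let f ∈ K[x,y] be a polynomial of total degree at most d which is geometrically reduced (squarefree as an element of K̄[x,y]), written f = Σ_{i=0}^n f_i(x)·y^i with f_i ∈ K[x], n = deg_y f, and f₀ ≠ 0, f_n ≠ 0. Then the following are equivalent: (A) f is quasi-homogeneous with the weight of x nonzero, i.e. there exist integers w, α, β with α ≠ 0 such that α·i + β·j = w for every monomial x^i y^j appearing in f with nonzero coefficient; (B) f₀ and f_n are nonzero monomials in x, and for every a ∈ K̄ with a ≠ 0 the univariate polynomial f(a, y) ∈ K̄[y] has degree n and no repeated root in K̄. -/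

import Mathlib

open Polynomial

/-- A univariate polynomial over a field `K` is a nonzero monomial. -/
def IsNonzeroMonomial {K : Type*} [Field K] (p : Polynomial K) : Prop :=
  ∃ (c : K) (k : ℕ), c ≠ 0 ∧ p = C c * X ^ k

section Integrality

theorem isIntegral_of_forall_valuationSubring {R L : Type*} [CommRing R] [Field L] [Algebra R L]
    {z : L} (h : ∀ W : ValuationSubring L, (∀ r : R, algebraMap R L r ∈ W) → z ∈ W) :
    IsIntegral R z := by
  have hz : z ∈ (integralClosure (Subring.closure (Set.range (algebraMap R L))) L).toSubring := by
    rw [← iInf_valuationSubring_superset, Subring.mem_iInf]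
    exact fun W ↦ h W.1 fun r ↦ W.2 ⟨r, rfl⟩
  have hz' : IsIntegral (Subring.closure (Set.range (algebraMap R L))) z := hz
  rw [← RingHom.coe_range, Subring.closure_eq] at hz'
  obtain ⟨p, hp, hpz⟩ := hz'
  obtain ⟨q, hq, hdeg, hqm⟩ := lifts_and_degree_eq_and_monic
    (f := (algebraMap R L).rangeRestrict)
    ((lifts_iff_coeff_lifts _).mpr fun n ↦ (algebraMap R L).rangeRestrict_surjective _) hp
  refine ⟨q, hqm, ?_⟩
  rw [← hpz, ← hq, eval₂_map]
  rfl

theorem exists_algebraMap_eq_of_forall_valuationSubring {k L : Type*} [Field k] [IsAlgClosed k]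
    [Field L] [Algebra k L] {z : L}
    (h : ∀ W : ValuationSubring L, (∀ c : k, algebraMap k L c ∈ W) → z ∈ W) :
    ∃ c : k, algebraMap k L c = z :=
  minpoly.mem_range_of_degree_eq_one k z <| IsAlgClosed.degree_eq_one_of_irreducible k <|
    minpoly.irreducible <| isIntegral_of_forall_valuationSubring h

end Integrality

section LocalEstimate

variable {k L Γ₀ : Type*} [Field k] [Field L]

theorem exists_primitive_relation (F : Type*) [Field F] [Algebra k[X] F] [Algebra k[X] L]
    [IsFractionRing k[X] F] [Algebra F L] [IsScalarTower k[X] F L] [FiniteDimensional F L]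
    (hx0 : algebraMap k[X] L X ≠ 0) (z : L) :
    ∃ P : k[X][X], aeval z P = 0 ∧ ∃ i, ¬ X ∣ P.coeff i := by
  have : IsAlgebraic k[X] z :=
    (IsFractionRing.isAlgebraic_iff k[X] F L).mpr (Algebra.IsAlgebraic.isAlgebraic z)
  obtain ⟨P, hP, hPz⟩ := this
  obtain ⟨N, Q, hQ, rfl⟩ := WfDvdMonoid.max_power_factor hP
    (prime_C_iff.mpr (prime_X (R := k))).irreducible
  refine ⟨Q, ?_, ?_⟩
  · simpa [hx0] using hPz
  · rw [C_dvd_iff_dvd_coeff] at hQ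
    push Not at hQ
    exact hQ

variable [Algebra k L] [LinearOrderedCommGroupWithZero Γ₀] {v : Valuation L Γ₀}

theorem valuation_algebraMap_eq_one (hv : ∀ c : k, v (algebraMap k L c) ≤ 1) {c : k}
    (hc : c ≠ 0) : v (algebraMap k L c) = 1 := by
  refine le_antisymm (hv c) ?_
  have h := hv c⁻¹
  rw [map_inv₀, map_inv₀] at h
  have h0 : v (algebraMap k L c) ≠ 0 := by simpa using hc
  exact (inv_le_one₀ (zero_lt_iff.mpr h0)).mp h

variable [Algebra k[X] L] [IsScalarTower k k[X] L]

theorem valuation_polynomial_le_one (hv : ∀ c : k, v (algebraMap k L c) ≤ 1)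
    (hx : v (algebraMap k[X] L X) ≤ 1) (q : k[X]) : v (algebraMap k[X] L q) ≤ 1 := by
  induction q using Polynomial.induction_on' with
  | add p q hp hq => rw [map_add]; exact (v.map_add _ _).trans (max_le hp hq)
  | monomial n a =>
    rw [← C_mul_X_pow_eq_monomial, map_mul, map_mul, map_pow, map_pow,
      ← Polynomial.algebraMap_eq, ← IsScalarTower.algebraMap_apply k k[X] L]
    exact mul_le_one' (hv a) (pow_le_one' hx n)

theorem valuation_polynomial_eq_one (hv : ∀ c : k, v (algebraMap k L c) ≤ 1)
    (hx : v (algebraMap k[X] L X) < 1) {q : k[X]} (hq : ¬ X ∣ q) :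
    v (algebraMap k[X] L q) = 1 := by
  rw [X_dvd_iff] at hq
  have h := valuation_algebraMap_eq_one hv hq
  rw [← divX_mul_X_add q, map_add, map_mul, ← Polynomial.algebraMap_eq,
    ← IsScalarTower.algebraMap_apply k k[X] L, v.map_add_eq_of_lt_right, h]
  rw [h, map_mul]
  exact mul_lt_one_of_nonneg_of_lt_one_right (valuation_polynomial_le_one hv hx.le _) zero_le hx

theorem exists_valuation_polynomial_eq_pow (hv : ∀ c : k, v (algebraMap k L c) ≤ 1)
    (hx : v (algebraMap k[X] L X) < 1) {q : k[X]} (hq : q ≠ 0) :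
    ∃ N : ℕ, v (algebraMap k[X] L q) = v (algebraMap k[X] L X) ^ N := by
  obtain ⟨N, a, ha, rfl⟩ := WfDvdMonoid.max_power_factor hq (irreducible_X (R := k))
  exact ⟨N, by rw [map_mul, map_mul, valuation_polynomial_eq_one hv hx ha, mul_one, map_pow,
    map_pow]⟩

variable {F : Type*} [Field F] [Algebra k[X] F] [IsFractionRing k[X] F] [Algebra F L]
  [IsScalarTower k[X] F L]

theorem exists_valuation_algebraMap_eq_zpow (hv : ∀ c : k, v (algebraMap k L c) ≤ 1)
    (hx : v (algebraMap k[X] L X) < 1) (hx0 : algebraMap k[X] L X ≠ 0) {a : F} (ha : a ≠ 0) :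
    ∃ N : ℤ, v (algebraMap F L a) = v (algebraMap k[X] L X) ^ N := by
  obtain ⟨r, s, hs, rfl⟩ := IsFractionRing.div_surjective (A := k[X]) a
  have hs0 : s ≠ 0 := nonZeroDivisors.ne_zero hs
  have hr0 : r ≠ 0 := by rintro rfl; simp at ha
  obtain ⟨m, hm⟩ := exists_valuation_polynomial_eq_pow hv hx hr0
  obtain ⟨n, hn⟩ := exists_valuation_polynomial_eq_pow hv hx hs0
  refine ⟨m - n, ?_⟩
  rw [map_div₀, map_div₀, ← IsScalarTower.algebraMap_apply, ← IsScalarTower.algebraMap_apply,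
    hm, hn, zpow_sub₀ (by simpa using hx0), zpow_natCast, zpow_natCast]

/-- Two terms of a vanishing sum share their valuation. -/
theorem exists_ne_valuation_eq_of_sum_eq_zero {ι : Type*} {s : Finset ι} {f : ι → L}
    (hs : s.Nonempty) (hf : ∀ i ∈ s, f i ≠ 0) (h : ∑ i ∈ s, f i = 0) :
    ∃ i ∈ s, ∃ j ∈ s, i ≠ j ∧ v (f i) = v (f j) := by
  classical
  obtain ⟨j, hj, hmax⟩ := s.exists_max_image (fun i ↦ v (f i)) hs
  by_contra! hne
  have := v.map_sum_eq_of_lt hj (f := f) (fun i hi ↦ by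
    simp only [Finset.mem_sdiff, Finset.mem_singleton] at hi
    exact (hmax i hi.1).lt_of_ne (hne i hi.1 j hj hi.2))
  rw [h, map_zero, eq_comm, map_eq_zero] at this
  exact hf j hj this

theorem exists_valuation_pow_eq_zpow [FiniteDimensional F L]
    (hv : ∀ c : k, v (algebraMap k L c) ≤ 1)
    (hx : v (algebraMap k[X] L X) < 1) (hx0 : algebraMap k[X] L X ≠ 0) {z : L} (hz : z ≠ 0) :
    ∃ m : ℕ, 0 < m ∧ m ≤ Module.finrank F L ∧
      ∃ N : ℤ, v z ^ m = v (algebraMap k[X] L X) ^ N := by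
  set P := minpoly F z
  have hP : P ≠ 0 := minpoly.ne_zero (IsIntegral.of_finite F z)
  have hsum : ∑ i ∈ P.support, algebraMap F L (P.coeff i) * z ^ i = 0 := by
    have := minpoly.aeval F z
    rwa [aeval_def, eval₂_eq_sum, Polynomial.sum_def] at this
  obtain ⟨i, hi, j, hj, hij, h⟩ := exists_ne_valuation_eq_of_sum_eq_zero (v := v)
    (by simpa using hP) (fun i hi ↦ by simpa [hz] using hi) hsum
  wlog hlt : i < j generalizing i j
  · exact this j hj i hi hij.symm h.symm (by omega)
  have hci : P.coeff i ≠ 0 := by simpa using hi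
  have hcj : P.coeff j ≠ 0 := by simpa using hj
  obtain ⟨M, hM⟩ := exists_valuation_algebraMap_eq_zpow hv hx hx0 hci
  obtain ⟨N, hN⟩ := exists_valuation_algebraMap_eq_zpow hv hx hx0 hcj
  have hjd : j - i ≤ P.natDegree := (Nat.sub_le _ _).trans <| le_natDegree_of_ne_zero hcj
  refine ⟨j - i, by omega, hjd.trans (minpoly.natDegree_le z), M - N, ?_⟩
  have hvx : v (algebraMap k[X] L X) ≠ 0 := by simpa using hx0
  have hvz : v z ≠ 0 := by simpa using hz
  rw [map_mul, map_mul, hM, hN, map_pow, map_pow] at h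
  rw [zpow_sub₀ hvx, eq_div_iff (zpow_ne_zero _ hvx)]
  apply mul_right_cancel₀ (pow_ne_zero i hvz)
  rw [h, mul_right_comm, ← pow_add, Nat.sub_add_cancel hlt.le, mul_comm]

/-- An element of valuation one is congruent to a constant. -/
theorem exists_valuation_sub_algebraMap_lt_one [IsAlgClosed k] (F : Type*) [Field F]
    [Algebra k[X] F] [IsFractionRing k[X] F] [Algebra F L] [IsScalarTower k[X] F L]
    [FiniteDimensional F L] (hv : ∀ c : k, v (algebraMap k L c) ≤ 1)
    (hx : v (algebraMap k[X] L X) < 1) (hx0 : algebraMap k[X] L X ≠ 0) {z : L} (hz : v z ≤ 1) :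
    ∃ c : k, v (z - algebraMap k L c) < 1 := by
  obtain ⟨P, hP, i, hi⟩ := exists_primitive_relation F hx0 z
  set Q : k[X] := P.map constantCoeff with hQdef
  have hQ : Q ≠ 0 := fun h ↦ hi <| X_dvd_iff.mpr <| by
    simpa [Q, coeff_map] using congr_arg (fun q ↦ q.coeff i) h
  have hQz : v (aeval z Q) < 1 := by
    have h : aeval z Q = -∑ j ∈ P.support,
        algebraMap k[X] L (P.coeff j).divX * algebraMap k[X] L X * z ^ j := by
      rw [eq_neg_iff_add_eq_zero, ← hP, aeval_def, hQdef, eval₂_map, aeval_def, eval₂_eq_sum,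
        eval₂_eq_sum, Polynomial.sum_def, Polynomial.sum_def, ← Finset.sum_add_distrib]
      refine Finset.sum_congr rfl fun j _ ↦ ?_
      conv_rhs => rw [← divX_mul_X_add (P.coeff j)]
      rw [map_add, map_mul, RingHom.comp_apply, constantCoeff_apply, ← Polynomial.algebraMap_eq,
        ← IsScalarTower.algebraMap_apply k k[X] L]
      ring
    rw [h, Valuation.map_neg]
    refine v.map_sum_lt one_ne_zero fun j _ ↦ ?_
    rw [map_mul, map_mul, map_pow]
    exact mul_lt_one_of_lt_of_le (mul_lt_one_of_nonneg_of_lt_one_right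
      (valuation_polynomial_le_one hv hx.le _) zero_le hx) (pow_le_one' hz j)
  by_contra! hne
  refine hQz.not_ge ?_
  rw [(IsAlgClosed.splits Q).eq_prod_roots, map_mul, aeval_C, map_mul,
    valuation_algebraMap_eq_one hv (leadingCoeff_ne_zero.mpr hQ), one_mul, map_multiset_prod,
    map_multiset_prod, Multiset.map_map, Multiset.map_map]
  refine Multiset.one_le_prod ?_
  intro y hy
  obtain ⟨c, -, rfl⟩ := Multiset.mem_map.mp hy
  simpa using hne c

/-- Every element of the valuation ring of `v` is a quotient of two elements that are integral
over `k[X]`, the denominator being a unit of the valuation ring. -/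
theorem exists_integral_div_eq (F : Type*) [Field F]
    [Algebra k[X] F] [IsFractionRing k[X] F] [Algebra F L] [IsScalarTower k[X] F L]
    [FiniteDimensional F L] (hv : ∀ c : k, v (algebraMap k L c) ≤ 1)
    (hx : v (algebraMap k[X] L X) < 1) (hx0 : algebraMap k[X] L X ≠ 0) {z : L} (hz : v z ≤ 1) :
    ∃ r s : L, IsIntegral k[X] r ∧ IsIntegral k[X] s ∧ v s = 1 ∧ z = r / s := by
  classical
  obtain ⟨P, hP, i₀, hi₀⟩ := exists_primitive_relation F hx0 z
  have hi₀' : i₀ ≤ P.natDegree := le_natDegree_of_ne_zero fun h ↦ hi₀ (h ▸ dvd_zero X)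
  set M := P.natDegree with hM
  set j := Nat.findGreatest (fun i ↦ ¬ X ∣ P.coeff i) M with hj
  have hPj : ¬ X ∣ P.coeff j := Nat.findGreatest_spec (P := fun i ↦ ¬ X ∣ P.coeff i) hi₀' hi₀
  have hPlt : ∀ i, j < i → X ∣ P.coeff i := fun i hi ↦ by
    by_cases hiM : i ≤ M
    · exact not_not.mp (Nat.findGreatest_is_greatest hi hiM)
    · rw [coeff_eq_zero_of_natDegree_lt (by omega)]; exact dvd_zero X
  set a : ℕ → L := fun i ↦ algebraMap k[X] L (P.coeff i) with ha
  set s : L := ∑ l ∈ Finset.range (M + 1), a (j + l) * z ^ l with hs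
  have hrel : ∑ i ∈ Finset.range j, a i * z ^ i + z ^ j * s = 0 := by
    rw [← hP, aeval_eq_sum_range' (show P.natDegree < j + (M + 1) by omega), Finset.sum_range_add,
      hs, Finset.mul_sum]
    congr 1
    · exact Finset.sum_congr rfl fun i _ ↦ by rw [Algebra.smul_def]
    · exact Finset.sum_congr rfl fun i _ ↦ by rw [Algebra.smul_def]; ring
  have hvs : v s = 1 := by
    have h1 : v (a j) = 1 := valuation_polynomial_eq_one hv hx hPj
    rw [hs, Finset.sum_range_succ', add_zero, pow_zero, mul_one, v.map_add_eq_of_lt_right, h1]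
    rw [h1]
    refine v.map_sum_lt one_ne_zero fun l _ ↦ ?_
    obtain ⟨q, hq⟩ := hPlt (j + (l + 1)) (by omega)
    rw [ha, map_mul, map_pow]
    simp only [hq, map_mul]
    exact mul_lt_one_of_lt_of_le (mul_lt_one_of_lt_of_le hx
      (valuation_polynomial_le_one hv hx.le _)) (pow_le_one' hz _)
  have hs0 : s ≠ 0 := by rintro h; simp [h] at hvs
  have hsint : ∀ W : ValuationSubring L, (∀ r : k[X], algebraMap k[X] L r ∈ W) →
      z ∈ W → s ∈ W := fun W hW hzW ↦
    sum_mem fun l _ ↦ mul_mem (hW _) (pow_mem hzW l)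
  have hinv : ∀ m ≤ 1, z ≠ 0 → s * z ^ m = -∑ i ∈ Finset.range j, a i * z⁻¹ ^ (j - i - m) := by
    intro m hm hz0
    apply mul_right_cancel₀ (pow_ne_zero j hz0)
    have e : z ^ j * s = -∑ i ∈ Finset.range j, a i * z ^ i := eq_neg_of_add_eq_zero_right hrel
    rw [mul_right_comm, mul_comm s, e, neg_mul, neg_mul, Finset.sum_mul, Finset.sum_mul]
    congr 1
    refine Finset.sum_congr rfl fun i hi ↦ ?_
    rw [Finset.mem_range] at hi
    have : z ^ j = z ^ (j - i - m) * z ^ i * z ^ m := by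
      rw [← pow_add, ← pow_add]; congr 1; omega
    rw [this, inv_pow]
    field_simp
  have hsint' : ∀ W : ValuationSubring L, (∀ r : k[X], algebraMap k[X] L r ∈ W) →
      ∀ m ≤ 1, s * z ^ m ∈ W := fun W hW m hm ↦ by
    rcases W.mem_or_inv_mem z with hzW | hzW
    · exact mul_mem (hsint W hW hzW) (pow_mem hzW m)
    · by_cases hz0 : z = 0
      · have hzW : z ∈ W := hz0 ▸ zero_mem W
        exact mul_mem (hsint W hW hzW) (pow_mem hzW m)
      · rw [hinv m hm hz0]
        exact neg_mem (sum_mem fun i _ ↦ mul_mem (hW _) (pow_mem hzW _))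
  refine ⟨s * z, s, ?_, ?_, hvs, by field_simp⟩
  · exact isIntegral_of_forall_valuationSubring fun W hW ↦ by simpa using hsint' W hW 1 le_rfl
  · exact isIntegral_of_forall_valuationSubring fun W hW ↦ by
      simpa using hsint' W hW 0 zero_le_one

theorem valuation_le_one_of_eval_eq_zero {P : L[X]} (hc : ∀ i, v (P.coeff i) ≤ 1)
    (hl : v P.leadingCoeff = 1) {z : L} (h : P.eval z = 0) : v z ≤ 1 := by
  by_contra! hz
  rw [eval_eq_sum_range] at h
  have hlast : v (P.coeff P.natDegree * z ^ P.natDegree) = v z ^ P.natDegree := by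
    rw [map_mul, map_pow, coeff_natDegree, hl, one_mul]
  have := v.map_sum_eq_of_lt (Finset.self_mem_range_succ P.natDegree)
    (f := fun i ↦ P.coeff i * z ^ i) (fun i hi ↦ by
      have hi' : i < P.natDegree := by
        simp only [Finset.mem_sdiff, Finset.mem_range, Finset.mem_singleton] at hi; omega
      rw [hlast, map_mul, map_pow]
      exact (mul_le_of_le_one_left zero_le (hc i)).trans_lt (pow_lt_pow_right₀ hz hi'))
  rw [h, map_zero, hlast] at this
  exact (pow_pos (zero_lt_one.trans hz) _).ne this

theorem valuation_le_one_of_isIntegral (hv : ∀ c : k, v (algebraMap k L c) ≤ 1)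
    (hx : v (algebraMap k[X] L X) ≤ 1) {z : L} (hz : IsIntegral k[X] z) : v z ≤ 1 := by
  obtain ⟨P, hP, h⟩ := hz
  refine valuation_le_one_of_eval_eq_zero (P := P.map (algebraMap k[X] L)) (fun i ↦ ?_) ?_
    (by rwa [eval_map])
  · rw [coeff_map]; exact valuation_polynomial_le_one hv hx _
  · rw [(hP.map _).leadingCoeff, map_one]

section Derivation

variable (D : Derivation k L L)

theorem derivation_algebraMap (a : k[X]) : D (algebraMap k[X] L a) =
    algebraMap k[X] L (derivative a) * D (algebraMap k[X] L X) := by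
  have := D.map_aeval a (algebraMap k[X] L X)
  rwa [aeval_algebraMap_apply, aeval_X_left_apply, aeval_algebraMap_apply, aeval_X_left_apply,
    smul_eq_mul] at this

/-- A derivation of `L` preserves integrality over `k[X]` up to a common denominator. -/
theorem exists_isIntegral_mul_derivation (F : Type*) [Field F] [Algebra k[X] F]
    [IsFractionRing k[X] F] [Algebra F L] [IsScalarTower k[X] F L] [FiniteDimensional F L]
    [Algebra.IsSeparable F L] {d : k[X]}
    (hD : D (algebraMap k[X] L X) = algebraMap k[X] L d) :
    ∃ q : k[X], q ≠ 0 ∧ ∀ r, IsIntegral k[X] r → IsIntegral k[X] (algebraMap k[X] L q * D r) := by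
  classical
  have hN := IsIntegralClosure.isNoetherian k[X] F L (integralClosure k[X] L)
  obtain ⟨S, hS⟩ : (Subalgebra.toSubmodule (integralClosure k[X] L)).FG :=
    Module.Finite.iff_fg.mp (Module.IsNoetherian.finite k[X] (integralClosure k[X] L))
  have hex : ∀ e : L, ∃ q : k[X], q ≠ 0 ∧ IsIntegral k[X] (q • D e) := fun e ↦
    ((IsFractionRing.isAlgebraic_iff k[X] F L).mpr
      (Algebra.IsAlgebraic.isAlgebraic (D e))).exists_integral_multiple
  choose q hq0 hq using hex
  refine ⟨∏ e ∈ S, q e, Finset.prod_ne_zero_iff.mpr fun e _ ↦ hq0 e, fun r hr ↦ ?_⟩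
  have hr' : r ∈ Submodule.span k[X] (S : Set L) := by rw [hS]; exact hr
  have hint : ∀ a : k[X], IsIntegral k[X] (algebraMap k[X] L a) := fun _ ↦ isIntegral_algebraMap
  induction hr' using Submodule.span_induction with
  | mem e he =>
    rw [← Finset.mul_prod_erase S q he, map_mul, mul_right_comm, ← Algebra.smul_def (q e)]
    exact (hq e).mul (hint _)
  | zero => simpa using isIntegral_zero
  | add a b ha hb iha ihb =>
    have mem : ∀ {a}, a ∈ Submodule.span k[X] (S : Set L) → IsIntegral k[X] a := fun h ↦ by
      rw [hS] at h; exact h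
    rw [map_add, mul_add]
    exact (iha (mem ha)).add (ihb (mem hb))
  | smul a b hb ihb =>
    have hb : IsIntegral k[X] b := by rw [hS] at hb; exact hb
    rw [Algebra.smul_def, D.leibniz, derivation_algebraMap, hD, smul_eq_mul, smul_eq_mul, mul_add,
      mul_left_comm]
    exact ((hint _).mul (ihb hb)).add ((hint _).mul (hb.mul ((hint _).mul (hint _))))

theorem exists_pow_mul_valuation_derivation_le_one (F : Type*) [Field F] [Algebra k[X] F]
    [IsFractionRing k[X] F] [Algebra F L] [IsScalarTower k[X] F L] [FiniteDimensional F L]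
    [Algebra.IsSeparable F L] {d : k[X]} (hD : D (algebraMap k[X] L X) = algebraMap k[X] L d)
    (hv : ∀ c : k, v (algebraMap k L c) ≤ 1)
    (hx : v (algebraMap k[X] L X) < 1) (hx0 : algebraMap k[X] L X ≠ 0) :
    ∃ N : ℕ, ∀ z, v z ≤ 1 → v (algebraMap k[X] L X) ^ N * v (D z) ≤ 1 := by
  obtain ⟨q, hq0, hq⟩ := exists_isIntegral_mul_derivation D F hD
  obtain ⟨N, hN⟩ := exists_valuation_polynomial_eq_pow hv hx hq0
  refine ⟨N, fun z hz ↦ ?_⟩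
  obtain ⟨r, s, hr, hs, hvs, rfl⟩ := exists_integral_div_eq F hv hx hx0 hz
  have hs0 : s ≠ 0 := by rintro rfl; simp at hvs
  have hle := fun {z : L} (hz : IsIntegral k[X] z) ↦ valuation_le_one_of_isIntegral hv hx.le hz
  have h : D (r / s) * s ^ 2 = s * D r - r * D s := by
    have := congr_arg D (div_mul_cancel₀ r hs0)
    rw [D.leibniz, smul_eq_mul, smul_eq_mul] at this
    rw [← this]; field_simp; ring
  have h' : v (D (r / s)) = v (s * D r - r * D s) := by
    rw [← h, map_mul, map_pow, hvs, one_pow, mul_one]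
  rw [← hN, h', ← map_mul, mul_sub, mul_left_comm, mul_left_comm _ r]
  exact hle ((hs.mul (hq r hr)).sub (hr.mul (hq s hs)))

variable (F : Type*) [Field F] [Algebra k[X] F]
  [IsFractionRing k[X] F] [Algebra F L] [IsScalarTower k[X] F L] [FiniteDimensional F L]

theorem exists_valuation_derivation_le_mul_max [IsAlgClosed k] {c₀ : k}
    (hD : D (algebraMap k[X] L X) = algebraMap k L c₀ * algebraMap k[X] L X)
    (hchar : ∀ m : ℕ, 0 < m → m ≤ Module.finrank F L → (m : k) ≠ 0)
    (hv : ∀ c : k, v (algebraMap k L c) ≤ 1)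
    (hx : v (algebraMap k[X] L X) < 1) (hx0 : algebraMap k[X] L X ≠ 0) {z : L} (hz : z ≠ 0) :
    ∃ ε, v ε < 1 ∧ v (D z) ≤ v z * max 1 (v (D ε)) := by
  obtain ⟨m, hm0, hm, N, hN⟩ := exists_valuation_pow_eq_zpow (F := F) hv hx hx0 hz
  set x := algebraMap k[X] L X
  have hxN : x ^ N ≠ 0 := zpow_ne_zero N hx0
  set u := z ^ m / x ^ N with hu
  have hvu : v u = 1 := by
    rw [hu, map_div₀, map_pow, map_zpow₀, hN, div_self (zpow_ne_zero _ (by simpa using hx0))]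
  have hu0 : u ≠ 0 := by intro h; simp [h] at hvu
  obtain ⟨c, hc⟩ := exists_valuation_sub_algebraMap_lt_one F hv hx hx0 hvu.le
  refine ⟨_, hc, ?_⟩
  have hDε : D (u - algebraMap k L c) = D u := by rw [map_sub, D.map_algebraMap, sub_zero]
  rw [hDε]
  have hvm : v (m : L) = 1 := by
    rw [← map_natCast (algebraMap k L)]
    exact valuation_algebraMap_eq_one hv (hchar m hm0 hm)
  have hvN : v ((N : L) * algebraMap k L c₀) ≤ 1 := by
    rw [← map_intCast (algebraMap k L), ← map_mul]
    exact hv _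
  have hDxN : D (x ^ N) = N * algebraMap k L c₀ * x ^ N := by
    rw [D.leibniz_zpow, hD, smul_eq_mul, zsmul_eq_mul, zpow_sub_one₀ hx0]
    field_simp
  have key : (m : L) * D z = z * (N * algebraMap k L c₀ + D u / u) := by
    have h1 : u * x ^ N = z ^ m := div_mul_cancel₀ _ hxN
    have h2 := congr_arg D h1
    rw [D.leibniz, D.leibniz_pow, hDxN, smul_eq_mul, smul_eq_mul, smul_eq_mul, nsmul_eq_mul] at h2
    obtain ⟨l, rfl⟩ : ∃ l, m = l + 1 := ⟨m - 1, by omega⟩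
    rw [Nat.add_sub_cancel] at h2
    apply mul_left_cancel₀ (pow_ne_zero l hz)
    have h3 : z ^ l * (z * (N * algebraMap k L c₀ + D u / u)) =
        z ^ (l + 1) * (N * algebraMap k L c₀ + D u / u) := by ring
    rw [h3, ← h1]
    field_simp
    linear_combination -h2
  calc v (D z) = v ((m : L) * D z) := by rw [map_mul, hvm, one_mul]
    _ = v z * v (N * algebraMap k L c₀ + D u / u) := by rw [key, map_mul]
    _ ≤ v z * max 1 (v (D u)) := by
      refine mul_le_mul_right ?_ _
      refine (v.map_add _ _).trans (max_le_max hvN ?_)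
      rw [map_div₀, hvu, div_one]

/-- Tameness: at a place over `X = 0`, the derivation `c₀ X d/dX` does not decrease orders. -/
theorem valuation_derivation_le [IsAlgClosed k] [Algebra.IsSeparable F L] {c₀ : k}
    (hD : D (algebraMap k[X] L X) = algebraMap k L c₀ * algebraMap k[X] L X)
    (hchar : ∀ m : ℕ, 0 < m → m ≤ Module.finrank F L → (m : k) ≠ 0)
    (hv : ∀ c : k, v (algebraMap k L c) ≤ 1)
    (hx : v (algebraMap k[X] L X) < 1) (hx0 : algebraMap k[X] L X ≠ 0) (z : L) :
    v (D z) ≤ v z := by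
  obtain ⟨N, hN⟩ := exists_pow_mul_valuation_derivation_le_one D F (d := C c₀ * X)
    (by rw [hD, map_mul, ← Polynomial.algebraMap_eq, ← IsScalarTower.algebraMap_apply k k[X] L])
    hv hx hx0
  have hmax := fun {z : L} (hz : z ≠ 0) ↦
    exists_valuation_derivation_le_mul_max D F hD hchar hv hx hx0 hz
  set x := algebraMap k[X] L X
  set G := (Module.finrank F L).factorial with hG
  have hG0 : G ≠ 0 := Nat.factorial_ne_zero _
  have hsmall : ∀ ε : L, v ε < 1 → v ε ^ G ≤ v x := by
    intro ε hε
    by_cases hε0 : ε = 0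
    · simp [hε0, hG0]
    obtain ⟨m, hm0, hm, M, hM⟩ := exists_valuation_pow_eq_zpow (F := F) hv hx hx0 hε0
    have hvx : 0 < v x := zero_lt_iff.mpr (by simpa using hx0)
    have hMpos : 0 < M := by
      by_contra! hM0
      have h1 : (1 : Γ₀) ≤ v x ^ M := one_le_zpow_of_nonpos₀ hvx hx.le hM0
      rw [← hM] at h1
      exact h1.not_gt (pow_lt_one₀ zero_le hε hm0.ne')
    obtain ⟨l, hl⟩ := Nat.dvd_factorial hm0 hm
    have hl0 : l ≠ 0 := by rintro rfl; exact hG0 (by rw [hG, hl, mul_zero])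
    lift M to ℕ using hMpos.le
    rw [hG, hl, pow_mul, hM, zpow_natCast, ← pow_mul]
    exact pow_le_of_le_one zero_le hx.le (mul_ne_zero (by omega) hl0)
  have hmulmax : ∀ M : ℕ, (∀ ε, v ε < 1 → v x ^ M * v (D ε) ^ G ≤ 1) →
      ∀ z, v x ^ M * v (D z) ^ G ≤ v z ^ G := by
    intro M hM z
    by_cases hz : z = 0
    · simp [hz, hG0]
    obtain ⟨ε, hε, h⟩ := hmax hz
    calc v x ^ M * v (D z) ^ G ≤ v x ^ M * (v z * max 1 (v (D ε))) ^ G := by gcongr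
      _ = v z ^ G * (v x ^ M * max 1 (v (D ε)) ^ G) := by rw [mul_pow, mul_left_comm]
      _ ≤ v z ^ G * 1 := by
        gcongr
        rcases max_cases (1 : Γ₀) (v (D ε)) with ⟨h, -⟩ | ⟨h, -⟩ <;> rw [h]
        · rw [one_pow, mul_one]; exact pow_le_one' hx.le _
        · exact hM ε hε
      _ = v z ^ G := mul_one _
  have hall : ∀ M : ℕ, (∀ z, v x ^ M * v (D z) ^ G ≤ v z ^ G) → ∀ z, v (D z) ^ G ≤ v z ^ G := by
    intro M
    induction M with
    | zero => intro h; simpa using h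
    | succ M ih =>
      refine fun h ↦ ih (hmulmax M fun ε hε ↦ ?_)
      have := (h ε).trans (hsmall ε hε)
      rw [pow_succ, mul_right_comm] at this
      have hvx : 0 < v x := zero_lt_iff.mpr (by simpa using hx0)
      exact (mul_le_iff_le_one_left hvx).mp this
  refine (pow_le_pow_iff_left₀ zero_le zero_le hG0).mp (hall (N * G) (hmulmax _ ?_) z)
  intro ε hε
  rw [pow_mul, ← mul_pow]
  exact pow_le_one' (hN ε hε.le) _

end Derivation

end LocalEstimate

section Generator

variable {k F L Γ₀ : Type*} [Field k] [Field F] [Field L] [Algebra k F] [Algebra F L] [Algebra k L]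
  [IsScalarTower k F L]

/-- `x` is a free generator of `F` as a field extension of `k`. -/
def IsRationalGenerator (k : Type*) {F : Type*} [Field k] [Field F] [Algebra k F] (x : F) : Prop :=
  Transcendental k x ∧ ∀ z : F, ∃ r s : k[X], s ≠ 0 ∧ z = aeval x r / aeval x s

theorem IsRationalGenerator.ne_zero {x : F} (hx : IsRationalGenerator k x) : x ≠ 0 := by
  rintro rfl
  exact hx.1 isAlgebraic_zero

theorem aeval_eq_aeval_inv_reverse_mul {x : F} (hx : x ≠ 0) (r : k[X]) :
    aeval x r = aeval x⁻¹ r.reverse * x ^ r.natDegree := by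
  let := invertibleOfNonzero hx
  rw [aeval_def, aeval_def, ← eval₂_reverse_mul_pow (algebraMap k F) x, invOf_eq_inv]

theorem IsRationalGenerator.inv {x : F} (hx : IsRationalGenerator k x) :
    IsRationalGenerator k x⁻¹ := by
  refine ⟨fun h ↦ hx.1 (by simpa using h.inv), fun z ↦ ?_⟩
  have hx0 := hx.ne_zero
  obtain ⟨r, s, hs, rfl⟩ := hx.2 z
  refine ⟨r.reverse * X ^ s.natDegree, s.reverse * X ^ r.natDegree,
    mul_ne_zero (by simpa using hs) (pow_ne_zero _ X_ne_zero), ?_⟩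
  rw [aeval_eq_aeval_inv_reverse_mul hx0 r, aeval_eq_aeval_inv_reverse_mul hx0 s, map_mul, map_mul,
    map_pow, map_pow, aeval_X, inv_pow, inv_pow]
  by_cases h : aeval x⁻¹ s.reverse = 0
  · simp [h]
  · field_simp

variable [LinearOrderedCommGroupWithZero Γ₀] {v : Valuation L Γ₀} [IsAlgClosed k]
  [FiniteDimensional F L] [Algebra.IsSeparable F L]

theorem valuation_derivation_le_of_lt_one {x : F} (hgen : IsRationalGenerator k x)
    (D : Derivation k L L) {c₀ : k}
    (hD : D (algebraMap F L x) = algebraMap k L c₀ * algebraMap F L x)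
    (hchar : ∀ m : ℕ, 0 < m → m ≤ Module.finrank F L → (m : k) ≠ 0)
    (hv : ∀ c : k, v (algebraMap k L c) ≤ 1) (hx : v (algebraMap F L x) < 1) (z : L) :
    v (D z) ≤ v z := by
  let : Algebra k[X] F := (aeval x).toAlgebra
  let : Algebra k[X] L := (aeval (algebraMap F L x)).toAlgebra
  have hF : ∀ r, algebraMap k[X] F r = aeval x r := fun _ ↦ rfl
  have hL : ∀ r, algebraMap k[X] L r = aeval (algebraMap F L x) r := fun _ ↦ rfl
  have : IsScalarTower k[X] F L := .of_algebraMap_eq fun r ↦ by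
    rw [hF, hL, aeval_algebraMap_apply]
  have : IsScalarTower k k[X] L := .of_algebraMap_eq fun r ↦ by
    rw [hL, Polynomial.algebraMap_eq, aeval_C]
  have : FaithfulSMul k[X] F := (faithfulSMul_iff_algebraMap_injective _ _).mpr
    (transcendental_iff_injective.mp hgen.1)
  have : IsFractionRing k[X] F := .of_field _ _ fun z ↦ by
    obtain ⟨r, s, -, h⟩ := hgen.2 z
    exact ⟨r, s, h⟩
  have hX : algebraMap k[X] L X = algebraMap F L x := by rw [hL, aeval_X]
  exact valuation_derivation_le D F (by rw [hX, hD]) hchar hv (by rwa [hX])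
    (by rw [hX]; simpa using hgen.ne_zero) z

theorem valuation_derivation_le_of_ne_one {x : F} (hgen : IsRationalGenerator k x)
    (D : Derivation k L L) (hD : D (algebraMap F L x) = algebraMap F L x)
    (hchar : ∀ m : ℕ, 0 < m → m ≤ Module.finrank F L → (m : k) ≠ 0)
    (hv : ∀ c : k, v (algebraMap k L c) ≤ 1) (hx : v (algebraMap F L x) ≠ 1) (z : L) :
    v (D z) ≤ v z := by
  rcases hx.lt_or_gt with hx | hx
  · exact valuation_derivation_le_of_lt_one hgen D (c₀ := 1) (by rw [hD, map_one, one_mul])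
      hchar hv hx z
  · refine valuation_derivation_le_of_lt_one hgen.inv D (c₀ := -1) ?_ hchar hv ?_ z
    · have hx0 : algebraMap F L x ≠ 0 := by simpa using hgen.ne_zero
      rw [map_inv₀, D.leibniz_inv, hD, smul_eq_mul, map_neg, map_one]
      field_simp
    · rw [map_inv₀, map_inv₀]
      exact inv_lt_one_of_one_lt₀ hx

/-- An element whose logarithmic derivative is regular at all places over `x ≠ 0, ∞` is an
eigenvector of the derivation `x d/dx`. -/
theorem exists_derivation_eq_mul {x : F} (hgen : IsRationalGenerator k x)
    (D : Derivation k L L) (hD : D (algebraMap F L x) = algebraMap F L x)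
    (hchar : ∀ m : ℕ, 0 < m → m ≤ Module.finrank F L → (m : k) ≠ 0) {y : L} (hy : y ≠ 0)
    (h : ∀ W : ValuationSubring L, (∀ c : k, algebraMap k L c ∈ W) →
      W.valuation (algebraMap F L x) = 1 → W.valuation (D y) ≤ W.valuation y) :
    ∃ c : k, D y = algebraMap k L c * y := by
  obtain ⟨c, hc⟩ := exists_algebraMap_eq_of_forall_valuationSubring (k := k) (z := D y / y)
    fun W hW ↦ by
      have hle : W.valuation (D y) ≤ W.valuation y := by
        by_cases hx : W.valuation (algebraMap F L x) = 1
        · exact h W hW hx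
        · exact valuation_derivation_le_of_ne_one hgen D hD hchar
            (fun c ↦ (W.valuation_le_one_iff _).mpr (hW c)) hx y
      rw [← W.valuation_le_one_iff, map_div₀]
      exact div_le_one_of_le₀ hle zero_le
  exact ⟨c, by rw [hc, div_mul_cancel₀ _ hy]⟩

end Generator

/-- The derivation `X d/dX` extends to finite separable extensions of `k(X)`. -/
theorem exists_derivation_X_eq_X (k F L : Type*) [Field k] [Field F] [Field L] [Algebra k[X] F]
    [IsFractionRing k[X] F] [Algebra F L] [Algebra k[X] L] [IsScalarTower k[X] F L] [Algebra k L]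
    [IsScalarTower k k[X] L] [Algebra.IsSeparable F L] :
    ∃ D : Derivation k L L, D (algebraMap k[X] L X) = algebraMap k[X] L X := by
  have : Algebra.FormallyEtale k[X] F := .of_isLocalization (nonZeroDivisors k[X])
  have : Algebra.FormallyEtale F L := .of_isSeparable F L
  have : Algebra.FormallyEtale k[X] L := .comp k[X] F L
  let l := (KaehlerDifferential.isBaseChange_of_formallyEtale k k[X] L).lift
    ((mkDerivation k (algebraMap k[X] L X)).liftKaehlerDifferential)
  refine ⟨(l.compDer (KaehlerDifferential.D k L)), ?_⟩
  have := (KaehlerDifferential.isBaseChange_of_formallyEtale k k[X] L).lift_eq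
    ((mkDerivation k (algebraMap k[X] L X)).liftKaehlerDifferential) (KaehlerDifferential.D k k[X] X)
  rw [KaehlerDifferential.map_D] at this
  simpa using this

section PairEval

variable {R S : Type*} [CommRing R] [CommRing S]

/-- Evaluation of a bivariate polynomial `f(x, y)`, along a ring homomorphism of scalars. -/
noncomputable def pairEval (i : R →+* S) (x y : S) : R[X][X] →+* S :=
  eval₂RingHom (eval₂RingHom i x) y

theorem pairEval_eq_eval_map (i : R →+* S) (x y : S) (f : R[X][X]) :
    pairEval i x y f = (f.map (eval₂RingHom i x)).eval y := by
  rw [pairEval, coe_eval₂RingHom, eval₂_eq_eval_map]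

theorem pairEval_C (i : R →+* S) (x y : S) (r : R[X]) : pairEval i x y (C r) = r.eval₂ i x := by
  simp [pairEval]

theorem map_pairEval {T : Type*} [CommRing T] (g : S →+* T) (i : R →+* S) (x y : S) (f : R[X][X]) :
    g (pairEval i x y f) = pairEval (g.comp i) (g x) (g y) f := by
  have : g.comp (pairEval i x y) = pairEval (g.comp i) (g x) (g y) := by
    ext <;> simp [pairEval]
  exact congr($this f)

theorem map_pairEval_self (g : R →+* S) (a b : R) (f : R[X][X]) :
    pairEval g (g a) (g b) f = g (pairEval (RingHom.id R) a b f) := by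
  rw [map_pairEval, RingHom.comp_id]

theorem pairEval_id (a b : R) (f : R[X][X]) :
    pairEval (RingHom.id R) a b f = (f.map (evalRingHom a)).eval b :=
  pairEval_eq_eval_map _ _ _ _

end PairEval

section Nonsingular

variable {k : Type*} [Field k] [IsAlgClosed k]

theorem exists_eq_of_eval₂_eq_zero {κ : Type*} [Field κ] (i : k →+* κ) {q : k[X]} (hq : q ≠ 0)
    {x : κ} (hx : q.eval₂ i x = 0) : ∃ a, i a = x :=
  (IsAlgClosed.splits q).mem_range_of_isRoot hq (by rwa [IsRoot, eval_map])

/-- If the fibres of `f` over the nonzero points of `k` are reduced, the fibres of `f` over all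
units are reduced. -/
theorem isUnit_pairEval_derivative {A : Type*} [CommRing A] [IsLocalRing A] {f u w : k[X][X]}
    {r : k[X]} (hr : r ≠ 0) (hf : u * f + w * derivative f = C r)
    (hfib : ∀ a b : k, a ≠ 0 → f.map (evalRingHom a) ≠ 0 ∧
      ¬ (pairEval (RingHom.id k) a b f = 0 ∧ pairEval (RingHom.id k) a b (derivative f) = 0))
    (i : k →+* A) {x y : A} (hx : IsUnit x) (hxy : pairEval i x y f = 0) :
    IsUnit (pairEval i x y (derivative f)) := by
  set g := IsLocalRing.residue A
  rw [← isUnit_map_iff g, isUnit_iff_ne_zero, map_pairEval]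
  intro h'
  have h : pairEval (g.comp i) (g x) (g y) f = 0 := by rw [← map_pairEval, hxy, map_zero]
  have hr' : r.eval₂ (g.comp i) (g x) = 0 := by
    rw [← pairEval_C (g.comp i) (g x) (g y), ← hf, map_add, map_mul, map_mul, h, h', mul_zero,
      mul_zero, add_zero]
  obtain ⟨a, ha⟩ := exists_eq_of_eval₂_eq_zero _ hr hr'
  have ha0 : a ≠ 0 := by
    rintro rfl
    rw [map_zero] at ha
    exact (hx.map g).ne_zero ha.symm
  have hmap : eval₂RingHom (g.comp i) (g x) = (g.comp i).comp (evalRingHom a) := by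
    rw [← ha]; ext <;> simp
  obtain ⟨b, hb⟩ := exists_eq_of_eval₂_eq_zero (g.comp i) (hfib a 0 ha0).1 (x := g y) (by
    rw [eval₂_map, ← hmap]; exact h)
  rw [← ha, ← hb, map_pairEval_self] at h h'
  exact (hfib a b ha0).2 ⟨(map_eq_zero (g.comp i)).mp h, (map_eq_zero (g.comp i)).mp h'⟩

end Nonsingular

/-- A simple root which is nondegenerate modulo all maximal ideals differs from any other root by
a unit. -/
theorem isUnit_sub_of_isUnit_eval_derivative {A : Type*} [CommRing A] [IsDomain A] {P : A[X]}
    {y z : A} (hy : P.eval y = 0) (hz : P.eval z = 0) (hyz : y ≠ z)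
    (h : IsUnit ((derivative P).eval y)) : IsUnit (y - z) := by
  obtain ⟨q, rfl⟩ := dvd_iff_isRoot.mpr hy
  have hqz : q.eval z = 0 := by simpa [sub_ne_zero.mpr hyz.symm] using hz
  have hqy : IsUnit (q.eval y) := by simpa using h
  have := sub_dvd_eval_sub y z q
  rw [hqz, sub_zero] at this
  exact isUnit_of_dvd_unit this hqy

theorem exists_polynomial_derivation_eval {k L : Type*} [Field k] [Field L] [Algebra k L]
    (D : Derivation k L L) (P : L[X]) :
    ∃ Q : L[X], (∀ i, Q.coeff i = D (P.coeff i)) ∧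
      ∀ y, D (P.eval y) = Q.eval y + (derivative P).eval y * D y := by
  induction P using Polynomial.induction_on' with
  | add p q hp hq =>
    obtain ⟨P, hP, hP'⟩ := hp
    obtain ⟨Q, hQ, hQ'⟩ := hq
    refine ⟨P + Q, fun i ↦ by simp [hP, hQ], fun y ↦ ?_⟩
    simp only [eval_add, map_add, hP', hQ']
    ring
  | monomial n a =>
    refine ⟨monomial n (D a), fun i ↦ ?_, fun y ↦ ?_⟩
    · rw [coeff_monomial, coeff_monomial]; split <;> simp
    · simp only [eval_monomial, derivative_monomial, D.leibniz, D.leibniz_pow, smul_eq_mul,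
        nsmul_eq_mul]
      ring

theorem isRationalGenerator_algebraMap_X (k F : Type*) [Field k] [Field F] [Algebra k[X] F]
    [IsFractionRing k[X] F] [Algebra k F] [IsScalarTower k k[X] F] :
    IsRationalGenerator k (algebraMap k[X] F X) := by
  have h : ∀ r : k[X], aeval (algebraMap k[X] F X) r = algebraMap k[X] F r := fun r ↦ by
    rw [aeval_algebraMap_apply, aeval_X_left_apply]
  refine ⟨transcendental_iff_injective.mpr fun r s hrs ↦ ?_, fun z ↦ ?_⟩
  · rw [h, h] at hrs
    exact IsFractionRing.injective k[X] F hrs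
  · obtain ⟨r, s, hs, rfl⟩ := IsFractionRing.div_surjective (A := k[X]) z
    exact ⟨r, s, nonZeroDivisors.ne_zero hs, by rw [h, h]⟩

theorem valuation_eq_one_of_eval_eq_zero {L Γ₀ : Type*} [Field L]
    [LinearOrderedCommGroupWithZero Γ₀] {v : Valuation L Γ₀} {P : L[X]}
    (hc : ∀ i, v (P.coeff i) ≤ 1) (hl : v P.leadingCoeff = 1) (h0 : v (P.coeff 0) = 1) {y : L}
    (hy : P.eval y = 0) : v y = 1 := by
  refine le_antisymm (valuation_le_one_of_eval_eq_zero hc hl hy) ?_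
  have hP0 : P.coeff 0 ≠ 0 := by intro h; simp [h] at h0
  have hy0 : y ≠ 0 := by
    rintro rfl
    exact hP0 (by rwa [coeff_zero_eq_eval_zero])
  have hvy : 0 < v y := zero_lt_iff.mpr (by simpa using hy0)
  let := invertibleOfNonzero hy0
  have hrev : P.reverse.eval y⁻¹ = 0 := by
    rw [← invOf_eq_inv, ← eval₂_id, eval₂_reverse_eq_zero_iff, eval₂_id, hy]
  have := valuation_le_one_of_eval_eq_zero (v := v) (P := P.reverse)
    (fun i ↦ by rw [coeff_reverse]; exact hc _)
    (by rw [reverse_leadingCoeff, trailingCoeff, natTrailingDegree_eq_zero.mpr (.inr hP0), h0]) hrev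
  rwa [map_inv₀, inv_le_one₀ hvy] at this

section Eigenvector

variable {k L : Type*} [Field k] [Field L] [Algebra k L]
  [Algebra k[X] L] [IsScalarTower k k[X] L]

theorem pairEval_algebraMap (g : k[X][X]) (z : L) :
    pairEval (algebraMap k L) (algebraMap k[X] L X) z g = (g.map (algebraMap k[X] L)).eval z := by
  have : algebraMap k[X] L = eval₂RingHom (algebraMap k L) (algebraMap k[X] L X) := by
    ext c
    · simp [IsScalarTower.algebraMap_apply k k[X] L]
    · simp
  rw [pairEval_eq_eval_map, ← this]

theorem X_mul_derivative_C_mul_X_pow (a : k) (b : ℕ) :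
    X * derivative (C a * X ^ b) = C (b : k) * (C a * X ^ b) := by
  rcases b with _ | b
  · simp
  · rw [derivative_C_mul_X_pow, Nat.add_sub_cancel, map_mul]
    ring

theorem valuation_root_eq_one {Γ₀ : Type*} [LinearOrderedCommGroupWithZero Γ₀]
    {v : Valuation L Γ₀} (hinj : Function.Injective (algebraMap k[X] L)) {f : k[X][X]}
    {a₀ a₁ : k} {a b : ℕ} (ha₀ : a₀ ≠ 0) (ha₁ : a₁ ≠ 0) (h0 : f.coeff 0 = C a₀ * X ^ a)
    (hn : f.leadingCoeff = C a₁ * X ^ b) (hv : ∀ c : k, v (algebraMap k L c) ≤ 1)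
    (hx : v (algebraMap k[X] L X) = 1) {y : L} (hy : (f.map (algebraMap k[X] L)).eval y = 0) :
    v y = 1 := by
  have hmon : ∀ {c : k} {m : ℕ}, c ≠ 0 → v (algebraMap k[X] L (C c * X ^ m)) = 1 := by
    intro c m hc
    rw [map_mul, map_mul, map_pow, map_pow, hx, one_pow, mul_one, ← Polynomial.algebraMap_eq,
      ← IsScalarTower.algebraMap_apply k k[X] L, valuation_algebraMap_eq_one hv hc]
  refine valuation_eq_one_of_eval_eq_zero (fun i ↦ ?_) ?_ ?_ hy
  · rw [coeff_map]; exact valuation_polynomial_le_one hv hx.le _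
  · rw [leadingCoeff_map_of_injective hinj, hn, hmon ha₁]
  · rw [coeff_map, h0, hmon ha₀]

variable [IsAlgClosed k]

/-- At a place over a point `x ≠ 0, ∞`, the roots of a polynomial with reduced fibres are units
which are pairwise distinct modulo the place. -/
theorem roots_reduced_of_fibres_reduced {f u w : k[X][X]} {r : k[X]} (hr : r ≠ 0)
    (hf : u * f + w * derivative f = C r)
    (hfib : ∀ a b : k, a ≠ 0 → f.map (evalRingHom a) ≠ 0 ∧
      ¬ (pairEval (RingHom.id k) a b f = 0 ∧ pairEval (RingHom.id k) a b (derivative f) = 0))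
    {W : ValuationSubring L} (hW : ∀ c : k, algebraMap k L c ∈ W)
    (hx : W.valuation (algebraMap k[X] L X) = 1) {y : L} (hyW : y ∈ W)
    (hy : (f.map (algebraMap k[X] L)).eval y = 0) :
    W.valuation ((derivative (f.map (algebraMap k[X] L))).eval y) = 1 ∧
      ∀ z ∈ W, (f.map (algebraMap k[X] L)).eval z = 0 → y ≠ z → W.valuation (y - z) = 1 := by
  have hxW : algebraMap k[X] L X ∈ W := (W.valuation_le_one_iff _).mp hx.le
  let i : k →+* W := (algebraMap k L).codRestrict W.toSubring hW
  have heval : ∀ (g : k[X][X]) (z : L) (hz : z ∈ W), (g.map (algebraMap k[X] L)).eval z =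
      W.subtype (pairEval i ⟨_, hxW⟩ ⟨z, hz⟩ g) := fun g z hz ↦ by
    rw [← pairEval_algebraMap, map_pairEval]
    rfl
  have hunit : ∀ z : W, IsUnit z ↔ W.valuation (z : L) = 1 := fun z ↦ W.valuation_eq_one_iff z
  have h0 : ∀ (z : L) (hz : z ∈ W), (f.map (algebraMap k[X] L)).eval z = 0 →
      pairEval i ⟨_, hxW⟩ ⟨z, hz⟩ f = 0 := fun z hz h ↦ by
    rw [heval f z hz] at h
    exact (map_eq_zero_iff _ W.subtype_injective).mp h
  have hd := isUnit_pairEval_derivative hr hf hfib i ((hunit ⟨_, hxW⟩).mpr hx) (h0 y hyW hy)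
  refine ⟨?_, fun z hz hz0 hyz ↦ ?_⟩
  · rw [derivative_map, heval _ y hyW]
    exact (hunit _).mp hd
  · have := isUnit_sub_of_isUnit_eval_derivative (P := f.map (eval₂RingHom i ⟨_, hxW⟩))
      (y := ⟨y, hyW⟩) (z := ⟨z, hz⟩) (by rw [← pairEval_eq_eval_map, h0 y hyW hy])
      (by rw [← pairEval_eq_eval_map, h0 z hz hz0]) (fun h ↦ hyz congr($h.1))
      (by rwa [derivative_map, ← pairEval_eq_eval_map])
    exact (hunit _).mp this

variable {F : Type*} [Field F] [Algebra k F] [Algebra k[X] F] [IsScalarTower k k[X] F]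
  [IsFractionRing k[X] F] [Algebra F L] [IsScalarTower k[X] F L] [IsScalarTower k F L]
  [FiniteDimensional F L] [Algebra.IsSeparable F L]

variable (F) in
/-- The roots of a polynomial with reduced fibres over `x ≠ 0, ∞` are eigenvectors of `x d/dx`,
with a common eigenvalue. -/
theorem exists_derivation_root_eq_mul {f u w : k[X][X]} {r : k[X]} (hr : r ≠ 0)
    (hf : u * f + w * derivative f = C r)
    (hfib : ∀ a b : k, a ≠ 0 → f.map (evalRingHom a) ≠ 0 ∧
      ¬ (pairEval (RingHom.id k) a b f = 0 ∧ pairEval (RingHom.id k) a b (derivative f) = 0))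
    (hchar : ∀ m : ℕ, 0 < m → m ≤ Module.finrank F L → (m : k) ≠ 0)
    {a₀ a₁ : k} {a b : ℕ} (ha₀ : a₀ ≠ 0) (ha₁ : a₁ ≠ 0) (h0 : f.coeff 0 = C a₀ * X ^ a)
    (hn : f.leadingCoeff = C a₁ * X ^ b) (D : Derivation k L L)
    (hD : D (algebraMap k[X] L X) = algebraMap k[X] L X) :
    ∃ c : k, ∀ y, (f.map (algebraMap k[X] L)).eval y = 0 → D y = algebraMap k L c * y := by
  have hinj : Function.Injective (algebraMap k[X] L) := by
    rw [IsScalarTower.algebraMap_eq k[X] F L]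
    exact (algebraMap F L).injective.comp (IsFractionRing.injective k[X] F)
  have hX : algebraMap F L (algebraMap k[X] F X) = algebraMap k[X] L X :=
    (IsScalarTower.algebraMap_apply _ _ _ _).symm
  set P := f.map (algebraMap k[X] L) with hP
  obtain ⟨Q, hQ, hQ'⟩ := exists_polynomial_derivation_eval D P
  have hv : ∀ {W : ValuationSubring L}, (∀ c : k, algebraMap k L c ∈ W) →
      ∀ c : k, W.valuation (algebraMap k L c) ≤ 1 := fun hW c ↦
    (ValuationSubring.valuation_le_one_iff _ _).mpr (hW c)
  have hy1 : ∀ {W : ValuationSubring L}, (∀ c : k, algebraMap k L c ∈ W) →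
      W.valuation (algebraMap k[X] L X) = 1 → ∀ {y}, P.eval y = 0 → W.valuation y = 1 :=
    fun hW hx _ hy ↦ valuation_root_eq_one hinj ha₀ ha₁ h0 hn (hv hW) hx hy
  have hyW : ∀ {W : ValuationSubring L}, (∀ c : k, algebraMap k L c ∈ W) →
      W.valuation (algebraMap k[X] L X) = 1 → ∀ {y}, P.eval y = 0 → y ∈ W :=
    fun hW hx _ hy ↦ (ValuationSubring.valuation_le_one_iff _ _).mp (hy1 hW hx hy).le
  have hDle : ∀ {W : ValuationSubring L}, (∀ c : k, algebraMap k L c ∈ W) →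
      W.valuation (algebraMap k[X] L X) = 1 → ∀ {y}, P.eval y = 0 → W.valuation (D y) ≤ 1 := by
    intro W hW hx y hy
    have h1 := (roots_reduced_of_fibres_reduced hr hf hfib hW hx (hyW hW hx hy) hy).1
    have h2 : Q.eval y + (derivative P).eval y * D y = 0 := by rw [← hQ', hy, map_zero]
    have h3 : W.valuation (D y) = W.valuation (Q.eval y) := by
      rw [eq_neg_of_add_eq_zero_left h2, Valuation.map_neg, map_mul, h1, one_mul]
    rw [h3, eval_eq_sum_range]
    refine W.valuation.map_sum_le fun i _ ↦ ?_
    rw [hQ, hP, coeff_map, derivation_algebraMap, hD, map_mul, map_mul, map_pow, hx,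
      hy1 hW hx hy, one_pow, mul_one, mul_one]
    exact valuation_polynomial_le_one (hv hW) hx.le _
  have hgen := isRationalGenerator_algebraMap_X k F
  have hroot0 : ∀ {y}, P.eval y = 0 → y ≠ 0 := by
    rintro _ hy rfl
    rw [← coeff_zero_eq_eval_zero, hP, coeff_map, map_eq_zero_iff _ hinj, h0] at hy
    simp [ha₀] at hy
  have hex : ∀ {y}, P.eval y = 0 → ∃ c : k, D y = algebraMap k L c * y := fun {y} hy ↦
    exists_derivation_eq_mul hgen D (by rw [hX, hD]) hchar (hroot0 hy) fun W hW hx ↦ by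
      rw [hX] at hx
      rw [hy1 hW hx hy]
      exact hDle hW hx hy
  by_cases hne : ∃ z, P.eval z = 0
  swap
  · exact ⟨0, fun y hy ↦ (hne ⟨y, hy⟩).elim⟩
  obtain ⟨z, hz⟩ := hne
  obtain ⟨c, hc⟩ := hex hz
  refine ⟨c, fun y hy ↦ ?_⟩
  by_cases hyz : y = z
  · rw [hyz, hc]
  obtain ⟨c', hc'⟩ := hex hy
  obtain ⟨e, he⟩ := exists_derivation_eq_mul hgen D (by rw [hX, hD]) hchar (sub_ne_zero.mpr hyz)
    fun W hW hx ↦ by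
      rw [hX] at hx
      rw [(roots_reduced_of_fibres_reduced hr hf hfib hW hx (hyW hW hx hy) hy).2 z
        (hyW hW hx hz) hz hyz, map_sub]
      exact (W.valuation.map_sub _ _).trans (max_le (hDle hW hx hy) (hDle hW hx hz))
  rw [map_sub, hc, hc'] at he
  have hrel : algebraMap k L (c' - e) * y = algebraMap k L (c - e) * z := by
    rw [map_sub, map_sub]
    linear_combination he
  by_cases hce : c = e
  · rw [hce, sub_self, map_zero, zero_mul, mul_eq_zero, or_iff_left (hroot0 hy),
      map_eq_zero, sub_eq_zero] at hrel
    rw [hc', hrel, hce]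
  · have hce' : algebraMap k L (c - e) ≠ 0 := by simpa [sub_eq_zero] using hce
    have h := congr_arg D hrel
    rw [D.leibniz, D.leibniz, D.map_algebraMap, D.map_algebraMap, hc, smul_zero, add_zero,
      smul_zero, add_zero, smul_eq_mul, smul_eq_mul, mul_left_comm, ← hrel] at h
    have hce'' : algebraMap k L (c' - e) ≠ 0 := by
      intro h0
      rw [h0, zero_mul, zero_eq_mul] at hrel
      exact hrel.elim hce' (hroot0 hz)
    apply mul_left_cancel₀ hce''
    rw [h]
    ring

variable (F) in
theorem exists_X_mul_derivative_coeff_eq {f u w : k[X][X]} {r : k[X]} (hr : r ≠ 0)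
    (hf : u * f + w * derivative f = C r)
    (hfib : ∀ a b : k, a ≠ 0 → f.map (evalRingHom a) ≠ 0 ∧
      ¬ (pairEval (RingHom.id k) a b f = 0 ∧ pairEval (RingHom.id k) a b (derivative f) = 0))
    (hchar : ∀ m : ℕ, 0 < m → m ≤ Module.finrank F L → (m : k) ≠ 0)
    {a₀ a₁ : k} {a b : ℕ} (ha₀ : a₀ ≠ 0) (ha₁ : a₁ ≠ 0) (h0 : f.coeff 0 = C a₀ * X ^ a)
    (hn : f.leadingCoeff = C a₁ * X ^ b) (hsplit : (f.map (algebraMap k[X] L)).Splits)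
    (hnodup : (f.map (algebraMap k[X] L)).roots.Nodup) :
    ∃ c : k, ∀ j, X * derivative (f.coeff j) = C (b + c * (f.natDegree - j)) * f.coeff j := by
  classical
  have hinj : Function.Injective (algebraMap k[X] L) := by
    rw [IsScalarTower.algebraMap_eq k[X] F L]
    exact (algebraMap F L).injective.comp (IsFractionRing.injective k[X] F)
  obtain ⟨D, hD⟩ := exists_derivation_X_eq_X k F L
  obtain ⟨c, hc⟩ := exists_derivation_root_eq_mul F hr hf hfib hchar ha₀ ha₁ h0 hn D hD
  refine ⟨c, ?_⟩
  set P := f.map (algebraMap k[X] L) with hP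
  obtain ⟨Q, hQ, hQ'⟩ := exists_polynomial_derivation_eval D P
  set n := f.natDegree
  set γ := algebraMap k L
  have hγ : ∀ e : k, algebraMap k[X] L (C e) = γ e := fun e ↦ by
    rw [← Polynomial.algebraMap_eq, ← IsScalarTower.algebraMap_apply k k[X] L]
  set h : L[X] := Q + C (γ c) * (X * derivative P) - C (γ (b + c * n)) * P with hdef
  have hcoeff : ∀ j, h.coeff j = algebraMap k[X] L
      (X * derivative (f.coeff j) - C (b + c * (n - j)) * f.coeff j) := by
    intro j
    have hX : (X * derivative P).coeff j = j * P.coeff j := by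
      rcases j with _ | j
      · simp
      · rw [coeff_X_mul, coeff_derivative]; push_cast; ring
    rw [hdef, coeff_sub, coeff_add, coeff_C_mul, coeff_C_mul, hQ, hX, hP, coeff_map,
      derivation_algebraMap, hD, map_sub, map_mul, map_mul, hγ, map_add, map_mul, map_add, map_mul,
      map_sub, map_natCast, map_natCast, map_natCast]
    ring
  have hh : h = 0 := by
    refine eq_zero_of_degree_lt_of_eval_finset_eq_zero P.roots.toFinset ?_ fun y hy ↦ ?_
    · rw [Multiset.toFinset_card_of_nodup hnodup, ← hsplit.natDegree_eq_card_roots,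
        natDegree_map_eq_of_injective hinj, degree_lt_iff_coeff_zero]
      intro j hj
      rw [hcoeff]
      rcases hj.eq_or_lt with rfl | hj
      · rw [coeff_natDegree, hn, X_mul_derivative_C_mul_X_pow, sub_self, mul_zero, add_zero,
          sub_self, map_zero]
      · simp [coeff_eq_zero_of_natDegree_lt hj]
    · have hy : P.eval y = 0 := by
        rw [Multiset.mem_toFinset] at hy
        exact isRoot_of_mem_roots hy
      have := hQ' y
      rw [hy, map_zero, hc y hy] at this
      rw [hdef, eval_sub, eval_add, eval_mul, eval_mul, eval_mul, eval_C, eval_C, eval_X, hy]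
      linear_combination -this
  intro j
  rw [← sub_eq_zero, ← map_eq_zero_iff _ hinj, ← hcoeff, hh, coeff_zero]

end Eigenvector

section Gauss

theorem Squarefree.map_fractionRing {R K : Type*} [CommRing R] [IsDomain R]
    [NormalizedGCDMonoid R] [Field K] [Algebra R K] [IsFractionRing R K] {f : R[X]}
    (hf : Squarefree f) : Squarefree (f.map (algebraMap R K)) := by
  intro g hg
  have hinj := IsFractionRing.injective R K
  have hf0 : f.map (algebraMap R K) ≠ 0 :=
    (Polynomial.map_ne_zero_iff hinj).mpr hf.ne_zero
  have hg0 : g ≠ 0 := by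
    rintro rfl
    exact hf0 (by simpa using hg)
  obtain ⟨b, hb, hbg⟩ := IsLocalization.integerNormalization_spec (nonZeroDivisors R) g
  refine isUnit_or_eq_zero_of_isUnit_integerNormalization_primPart (R := R) hg0 (hf _ ?_)
  set q := IsLocalization.integerNormalization (nonZeroDivisors R) g
  refine (isPrimitive_primPart q |>.mul (isPrimitive_primPart q)).dvd_of_fraction_map_dvd_fraction_map
    (K := K) (dvd_trans ?_ hg)
  have hdvd : q.primPart.map (algebraMap R K) ∣ g := by
    have hb0 : IsUnit (C (algebraMap R K b)) :=
      isUnit_C.mpr (IsUnit.mk0 _ (by simpa using nonZeroDivisors.ne_zero hb))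
    rw [← hb0.dvd_mul_left, ← smul_eq_C_mul, algebraMap_smul, ← hbg]
    exact Polynomial.map_dvd _ (primPart_dvd q)
  rw [Polynomial.map_mul]
  exact mul_dvd_mul hdvd hdvd

theorem Squarefree.separable_of_natDegree {K : Type*} [Field K] {f : K[X]} (hf : Squarefree f)
    (hchar : ∀ m : ℕ, 0 < m → m ≤ f.natDegree → (m : K) ≠ 0) : f.Separable := by
  refine EuclideanDomain.isCoprime_of_dvd (fun h ↦ hf.ne_zero h.1) fun g hg hg0 hgf hgf' ↦ ?_
  obtain ⟨q, hq, hqg⟩ := WfDvdMonoid.exists_irreducible_factor hg hg0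
  obtain ⟨h, rfl⟩ := hqg.trans hgf
  have hqh := hqg.trans hgf'
  rw [derivative_mul, dvd_add_left (dvd_mul_right q _)] at hqh
  have hsep : IsCoprime q (derivative q) := by
    refine (separable_iff_derivative_ne_zero hq).mpr fun h0 ↦ ?_
    have hdeg := hq.natDegree_pos
    have := congr_arg (fun p ↦ p.coeff (q.natDegree - 1)) h0
    simp only [coeff_derivative, coeff_zero, Nat.sub_add_cancel hdeg, mul_eq_zero,
      coeff_natDegree, leadingCoeff_eq_zero, hq.ne_zero, false_or] at this
    refine hchar _ hdeg (natDegree_le_of_dvd (dvd_mul_right q h) hf.ne_zero) ?_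
    rw [← this, ← Nat.cast_add_one, Nat.sub_add_cancel hdeg]
  exact hq.not_isUnit (hf q (mul_dvd_mul_left q (hsep.dvd_of_dvd_mul_left hqh)))

theorem Squarefree.separable_map_fractionRing {k : Type*} [Field k] {f : k[X][X]}
    (hf : Squarefree f) (hchar : ∀ m : ℕ, 0 < m → m ≤ f.natDegree → (m : k) ≠ 0) :
    (f.map (algebraMap k[X] (FractionRing k[X]))).Separable := by
  classical
  let := UniqueFactorizationMonoid.toNormalizedGCDMonoid k[X]
  refine Squarefree.separable_of_natDegree hf.map_fractionRing fun m hm0 hm ↦ ?_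
  rw [← map_natCast (algebraMap k _), _root_.map_ne_zero]
  exact hchar m hm0 (hm.trans natDegree_map_le)

theorem exists_bezout_of_separable_map {R K : Type*} [CommRing R] [IsDomain R] [Field K]
    [Algebra R K] [IsFractionRing R K] {f : R[X]} (hf : (f.map (algebraMap R K)).Separable) :
    ∃ (u w : R[X]) (r : R), r ≠ 0 ∧ u * f + w * derivative f = C r := by
  obtain ⟨u, w, h⟩ := hf
  obtain ⟨b, hb, hbu⟩ := IsLocalization.integerNormalization_spec (nonZeroDivisors R) u
  obtain ⟨c, hc, hcw⟩ := IsLocalization.integerNormalization_spec (nonZeroDivisors R) w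
  refine ⟨C c * IsLocalization.integerNormalization (nonZeroDivisors R) u,
    C b * IsLocalization.integerNormalization (nonZeroDivisors R) w, b * c,
    mul_ne_zero (nonZeroDivisors.ne_zero hb) (nonZeroDivisors.ne_zero hc), ?_⟩
  apply map_injective _ (IsFractionRing.injective R K)
  rw [derivative_map] at h
  simp only [Polynomial.map_add, Polynomial.map_mul, hbu, hcw, map_C, map_mul,
    ← algebraMap_smul K b, ← algebraMap_smul K c, smul_eq_C_mul]
  linear_combination (C (algebraMap R K b) * C (algebraMap R K c)) * h

theorem finrank_splittingField_dvd_factorial {F : Type*} [Field F] {p : F[X]} (hp : p.Separable) :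
    Module.finrank F p.SplittingField ∣ p.natDegree.factorial := by
  classical
  have : Fact ((p.map (algebraMap F p.SplittingField)).Splits) := ⟨SplittingField.splits p⟩
  rw [← Gal.card_of_separable hp, ← card_rootSet_eq_natDegree hp (SplittingField.splits p),
    ← Fintype.card_perm, ← Nat.card_eq_fintype_card]
  exact Subgroup.card_dvd_of_injective _ (Gal.galActionHom_injective p p.SplittingField)

end Gauss

/-- The relation satisfied by the exponents of a polynomial with reduced fibres over `x ≠ 0`. -/
theorem exists_exponent_relation {k : Type*} [Field k] [IsAlgClosed k] {f : k[X][X]}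
    (hf : Squarefree f) (hchar : ∀ m : ℕ, 0 < m → m ≤ f.natDegree.factorial → (m : k) ≠ 0)
    (hfib : ∀ a b : k, a ≠ 0 → f.map (evalRingHom a) ≠ 0 ∧
      ¬ (pairEval (RingHom.id k) a b f = 0 ∧ pairEval (RingHom.id k) a b (derivative f) = 0))
    {a₀ a₁ : k} {a b : ℕ} (ha₀ : a₀ ≠ 0) (ha₁ : a₁ ≠ 0) (h0 : f.coeff 0 = C a₀ * X ^ a)
    (hn : f.leadingCoeff = C a₁ * X ^ b) :
    ∃ c : k, ∀ i j, (f.coeff j).coeff i ≠ 0 → (i : k) = b + c * (f.natDegree - j) := by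
  let F := FractionRing k[X]
  have hdeg : (f.map (algebraMap k[X] F)).natDegree = f.natDegree :=
    natDegree_map_eq_of_injective (IsFractionRing.injective k[X] F) f
  have hsep : (f.map (algebraMap k[X] F)).Separable :=
    hf.separable_map_fractionRing fun m hm0 hm ↦ hchar m hm0 (hm.trans (Nat.self_le_factorial _))
  obtain ⟨u, w, r, hr, hbez⟩ := exists_bezout_of_separable_map hsep
  let L := (f.map (algebraMap k[X] F)).SplittingField
  have : Algebra.IsSeparable F L := Algebra.isSeparable_of_separable_splitting_field _ _ hsep
  have : IsScalarTower k k[X] L := .of_algebraMap_eq fun c ↦ by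
    rw [IsScalarTower.algebraMap_apply k F L, IsScalarTower.algebraMap_apply k k[X] F,
      ← IsScalarTower.algebraMap_apply k[X] F L]
  have hmap : (f.map (algebraMap k[X] F)).map (algebraMap F L) = f.map (algebraMap k[X] L) := by
    rw [map_map, ← IsScalarTower.algebraMap_eq]
  obtain ⟨c, hc⟩ := exists_X_mul_derivative_coeff_eq (L := L) F hr hbez hfib
    (fun m hm0 hm ↦ hchar m hm0 (hm.trans (Nat.le_of_dvd (Nat.factorial_pos _)
      (hdeg ▸ finrank_splittingField_dvd_factorial hsep)))) ha₀ ha₁ h0 hn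
    (hmap ▸ SplittingField.splits _) (hmap ▸ nodup_roots hsep.map)
  refine ⟨c, fun i j hij ↦ ?_⟩
  have := congr_arg (fun q ↦ q.coeff i) (hc j)
  simp only [coeff_C_mul] at this
  apply mul_right_cancel₀ hij
  rw [← this]
  rcases i with _ | i
  · simp
  · rw [coeff_X_mul, coeff_derivative]; push_cast; ring

section QuasiHomogeneous

theorem pairEval_quasiHomogeneous {k : Type*} [Field k] {g : k[X][X]} {w α β : ℤ}
    (hg : ∀ i j : ℕ, (g.coeff j).coeff i ≠ 0 → α * i + β * j = w) {t : k} (ht : t ≠ 0) (a b : k) :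
    pairEval (RingHom.id k) (t ^ α * a) (t ^ β * b) g =
      t ^ w * pairEval (RingHom.id k) a b g := by
  simp only [pairEval, coe_eval₂RingHom, eval₂_eq_sum, Polynomial.sum_def, Finset.mul_sum,
    Finset.sum_mul, RingHom.id_apply]
  refine Finset.sum_congr rfl fun j _ ↦ Finset.sum_congr rfl fun i hi ↦ ?_
  rw [← hg i j (mem_support_iff.mp hi), zpow_add₀ ht, zpow_mul, zpow_mul, mul_pow, mul_pow,
    zpow_natCast, zpow_natCast]
  ring

theorem IsAlgClosed.exists_zpow_eq {k : Type*} [Field k] [IsAlgClosed k] {c : k} (hc : c ≠ 0)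
    {α : ℤ} (hα : α ≠ 0) : ∃ t, t ≠ 0 ∧ t ^ α = c := by
  obtain ⟨s, hs⟩ := IsAlgClosed.exists_pow_nat_eq c (Int.natAbs_pos.mpr hα)
  have hs0 : s ≠ 0 := by
    rintro rfl
    rw [zero_pow (Int.natAbs_ne_zero.mpr hα)] at hs
    exact hc hs.symm
  rcases Int.natAbs_eq α with h | h
  · exact ⟨s, hs0, by rw [h, zpow_natCast, hs]⟩
  · exact ⟨s⁻¹, inv_ne_zero hs0, by rw [h, inv_zpow', neg_neg, zpow_natCast, hs]⟩

theorem exists_ne_zero_eval_ne_zero {k : Type*} [Field k] [Infinite k] {r : k[X]} (hr : r ≠ 0) :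
    ∃ a, a ≠ 0 ∧ r.eval a ≠ 0 := by
  by_contra! h
  refine mul_ne_zero X_ne_zero hr (Polynomial.funext fun a ↦ ?_)
  by_cases ha : a = 0
  · simp [ha]
  · simp [h a ha]

/-- The fibres over `x ≠ 0` of a reduced quasi-homogeneous polynomial are reduced. -/
theorem fibre_reduced_of_quasiHomogeneous {k : Type*} [Field k] [IsAlgClosed k] {f : k[X][X]}
    {w α β : ℤ} (hα : α ≠ 0) (hf : ∀ i j : ℕ, (f.coeff j).coeff i ≠ 0 → α * i + β * j = w)
    {p q : k[X][X]} {r : k[X]} (hr : r ≠ 0) (hbez : p * f + q * derivative f = C r)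
    {a b : k} (ha : a ≠ 0) :
    ¬ (pairEval (RingHom.id k) a b f = 0 ∧ pairEval (RingHom.id k) a b (derivative f) = 0) := by
  rintro ⟨h, h'⟩
  obtain ⟨a', ha', hra'⟩ := exists_ne_zero_eval_ne_zero hr
  obtain ⟨t, ht, hta⟩ := IsAlgClosed.exists_zpow_eq (div_ne_zero ha' ha) hα
  have hf' : ∀ i j : ℕ, ((derivative f).coeff j).coeff i ≠ 0 → α * i + β * j = w - β := by
    intro i j hij
    rw [coeff_derivative, ← Nat.cast_add_one, coeff_mul_natCast] at hij
    have := hf i (j + 1) (left_ne_zero_of_mul hij)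
    push_cast at this
    linarith
  have e := pairEval_quasiHomogeneous hf ht a b
  have e' := pairEval_quasiHomogeneous hf' ht a b
  rw [h, mul_zero, hta, div_mul_cancel₀ _ ha] at e
  rw [h', mul_zero, hta, div_mul_cancel₀ _ ha] at e'
  have := pairEval_C (RingHom.id k) a' (t ^ β * b) r
  rw [← hbez, map_add, map_mul, map_mul, e, e', mul_zero, mul_zero, add_zero, eval₂_id] at this
  exact hra' this.symm

theorem isNonzeroMonomial_of_subsingleton_support {K : Type*} [Field K] {q : K[X]} (hq : q ≠ 0)
    (h : ∀ i j, q.coeff i ≠ 0 → q.coeff j ≠ 0 → i = j) : IsNonzeroMonomial q :=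
  ⟨q.leadingCoeff, q.natDegree, leadingCoeff_ne_zero.mpr hq,
    (C_mul_X_pow_eq_self (Finset.card_le_one.mpr fun i hi j hj ↦
      h i j (mem_support_iff.mp hi) (mem_support_iff.mp hj))).symm⟩

/-- In large characteristic, the exponent relation modulo `p` lifts to the integers. -/
theorem intCast_relation_lift {k : Type*} [Field k] {p d : ℕ} [CharP k p] (hp : 3 * d ^ 2 < p)
    {a b i j n : ℕ} (ha : a ≤ d) (hbn : b + n ≤ d) (hij : i + j ≤ d) {c : k}
    (hi : (i : k) = b + c * (n - j)) (h0 : (a : k) = b + c * n) :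
    (n : ℤ) * i + ((a : ℤ) - b) * j = n * a := by
  have hcast : (((n : ℤ) * i + ((a : ℤ) - b) * j - n * a : ℤ) : k) = 0 := by
    push_cast
    rw [hi, h0]
    ring
  rw [CharP.intCast_eq_zero_iff k p] at hcast
  refine sub_eq_zero.mp (Int.eq_zero_of_abs_lt_dvd hcast (lt_of_le_of_lt ?_ (Nat.cast_lt.mpr hp)))
  zify at ha hbn hij
  push_cast
  have := Int.natCast_nonneg a
  have := Int.natCast_nonneg b
  have := Int.natCast_nonneg i
  have := Int.natCast_nonneg j
  have := Int.natCast_nonneg n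
  have h1 : (n : ℤ) * i ≤ d * d := by gcongr <;> linarith
  have h2 : (n : ℤ) * a ≤ d * d := by gcongr; linarith
  have h3 : |((a : ℤ) - b) * j| ≤ d * d := by
    rw [abs_mul, Nat.abs_cast]
    have : |(a : ℤ) - b| ≤ d := abs_le.mpr ⟨by linarith, by linarith⟩
    gcongr
    linarith
  rw [abs_le] at h3 ⊢
  constructor <;> nlinarith [mul_nonneg (Int.natCast_nonneg n) (Int.natCast_nonneg i),
    mul_nonneg (Int.natCast_nonneg n) (Int.natCast_nonneg a)]

end QuasiHomogeneous

section Transfer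

theorem natDegree_le_of_totalDegree_le {K : Type*} [Field K] {f : K[X][X]} {d : ℕ}
    (hd : ∀ i j : ℕ, (f.coeff j).coeff i ≠ 0 → i + j ≤ d) : f.natDegree ≤ d := by
  refine natDegree_le_iff_coeff_eq_zero.mpr fun j hj ↦ ?_
  by_contra h
  have := hd _ j (leadingCoeff_ne_zero.mpr h)
  omega

theorem natCast_ne_zero_of_le_factorial {k : Type*} [Field k] {p d : ℕ}
    [CharP k p] (hp : d.factorial < p) {n m : ℕ}
    (hn : n ≤ d) (hm0 : 0 < m) (hm : m ≤ n.factorial) : (m : k) ≠ 0 := by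
  rw [Ne, CharP.cast_eq_zero_iff k p]
  exact fun h ↦ ((Nat.le_of_dvd hm0 h).trans (hm.trans (Nat.factorial_le hn))).not_gt hp

variable {K k : Type*} [Field K] [Field k] [IsAlgClosed k] [Algebra K k] {f : K[X][X]} {p d : ℕ}

/-- A reduced quasi-homogeneous polynomial has reduced fibres. -/
theorem fibres_of_quasiHomogeneous [CharP k p] (hp : d.factorial < p)
    (hd : ∀ i j : ℕ, (f.coeff j).coeff i ≠ 0 → i + j ≤ d)
    (hsq : Squarefree (f.map (mapRingHom (algebraMap K k)))) (h0 : f.coeff 0 ≠ 0)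
    (hn : f.leadingCoeff ≠ 0) {w α β : ℤ} (hα : α ≠ 0)
    (hf : ∀ i j : ℕ, (f.coeff j).coeff i ≠ 0 → α * i + β * j = w) :
    IsNonzeroMonomial (f.coeff 0) ∧ IsNonzeroMonomial f.leadingCoeff ∧ ∀ a : k, a ≠ 0 →
      ((f.map (mapRingHom (algebraMap K k))).map (evalRingHom a)).natDegree = f.natDegree ∧
      ∀ b : k, ((f.map (mapRingHom (algebraMap K k))).map (evalRingHom a)).rootMultiplicity b
        ≤ 1 := by
  have hmon : ∀ j, f.coeff j ≠ 0 → IsNonzeroMonomial (f.coeff j) := fun j hj ↦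
    isNonzeroMonomial_of_subsingleton_support hj fun i i' hi hi' ↦ by
      have := (hf i j hi).trans (hf i' j hi').symm
      simpa [hα] using this
  refine ⟨hmon _ h0, hmon _ hn, fun a ha ↦ ?_⟩
  have hinj : Function.Injective (mapRingHom (algebraMap K k)) :=
    map_injective _ (algebraMap K k).injective
  set g := f.map (mapRingHom (algebraMap K k)) with hg
  have hdeg : g.natDegree = f.natDegree := natDegree_map_eq_of_injective hinj f
  have hga : evalRingHom a g.leadingCoeff ≠ 0 := by
    obtain ⟨c, m, hc, h⟩ := hmon _ hn
    rw [hg, leadingCoeff_map_of_injective hinj, leadingCoeff, h]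
    simpa [ha] using hc
  have hga0 : g.map (evalRingHom a) ≠ 0 := fun h ↦
    hga (by rw [leadingCoeff, ← coeff_map, h, coeff_zero])
  refine ⟨by rw [natDegree_map_of_leadingCoeff_ne_zero _ hga, hdeg], fun b ↦ ?_⟩
  obtain ⟨u, v, r, hr, hbez⟩ := exists_bezout_of_separable_map <|
    hsq.separable_map_fractionRing fun m hm0 hm ↦
      natCast_ne_zero_of_le_factorial hp (natDegree_le_of_totalDegree_le hd) hm0
        (hm.trans (hdeg ▸ Nat.self_le_factorial _))
  have hgw : ∀ i j : ℕ, (g.coeff j).coeff i ≠ 0 → α * i + β * j = w := fun i j hij ↦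
    hf i j fun h ↦ hij (by simp [hg, h])
  by_contra! hb
  obtain ⟨hb, hb'⟩ := (one_lt_rootMultiplicity_iff_isRoot hga0).mp hb
  refine fibre_reduced_of_quasiHomogeneous (b := b) hα hgw hr hbez ha ⟨?_, ?_⟩
  · rw [pairEval_id]; exact hb
  · rw [pairEval_id, ← derivative_map]; exact hb'

/-- A reduced polynomial with reduced fibres is quasi-homogeneous in large characteristic. -/
theorem quasiHomogeneous_of_fibres [CharP k p] (hp : d.factorial < p) (hp' : 3 * d ^ 2 < p)
    (hd : ∀ i j : ℕ, (f.coeff j).coeff i ≠ 0 → i + j ≤ d)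
    (hsq : Squarefree (f.map (mapRingHom (algebraMap K k))))
    (h0 : IsNonzeroMonomial (f.coeff 0)) (hn : IsNonzeroMonomial f.leadingCoeff)
    (hfib : ∀ a b : k, a ≠ 0 →
      ((f.map (mapRingHom (algebraMap K k))).map (evalRingHom a)).rootMultiplicity b ≤ 1) :
    ∃ w α β : ℤ, α ≠ 0 ∧ ∀ i j : ℕ, (f.coeff j).coeff i ≠ 0 → α * i + β * j = w := by
  have hinj : Function.Injective (mapRingHom (algebraMap K k)) :=
    map_injective _ (algebraMap K k).injective
  obtain ⟨a₀, a, ha₀, h0⟩ := h0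
  obtain ⟨a₁, b, ha₁, hn⟩ := hn
  have ha := hd a 0 (by rw [h0, coeff_C_mul_X_pow, if_pos rfl]; exact ha₀)
  have hb := hd b f.natDegree (by
    rw [coeff_natDegree, hn, coeff_C_mul_X_pow, if_pos rfl]; exact ha₁)
  set g := f.map (mapRingHom (algebraMap K k)) with hg
  have hdeg : g.natDegree = f.natDegree := natDegree_map_eq_of_injective hinj f
  have hg0 : g.coeff 0 = C (algebraMap K k a₀) * X ^ a := by simp [hg, h0]
  have hgn : g.leadingCoeff = C (algebraMap K k a₁) * X ^ b := by
    rw [hg, leadingCoeff_map_of_injective hinj, hn]; simp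
  have ha₀' : algebraMap K k a₀ ≠ 0 := by simpa using ha₀
  have ha₁' : algebraMap K k a₁ ≠ 0 := by simpa using ha₁
  obtain ⟨c, hc⟩ := exists_exponent_relation hsq (fun m hm0 hm ↦
      natCast_ne_zero_of_le_factorial hp (natDegree_le_of_totalDegree_le hd) hm0 (hdeg ▸ hm))
    (fun x y hx ↦ by
      have hgx : g.map (evalRingHom x) ≠ 0 := fun h ↦ by
        have : evalRingHom x g.leadingCoeff = 0 := by
          rw [leadingCoeff, ← coeff_map, h, coeff_zero]
        rw [hgn] at this
        simp [ha₁, hx] at this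
      refine ⟨hgx, fun h ↦ (hfib x y hx).not_gt ?_⟩
      rw [pairEval_id, pairEval_id, ← derivative_map] at h
      exact (one_lt_rootMultiplicity_iff_isRoot hgx).mpr h) ha₀' ha₁' hg0 hgn
  rw [hdeg] at hc
  have hcf : ∀ i j, (f.coeff j).coeff i ≠ 0 → (i : k) = b + c * (f.natDegree - j) :=
    fun i j hij ↦ hc i j (by simpa [hg] using hij)
  have hca : (a : k) = b + c * f.natDegree := by
    simpa using hc a 0 (by rw [hg0, coeff_C_mul_X_pow, if_pos rfl]; exact ha₀')
  by_cases hzero : f.natDegree = 0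
  · refine ⟨a, 1, 0, one_ne_zero, fun i j hij ↦ ?_⟩
    have hj : j = 0 := by
      by_contra hj
      exact hij (by rw [coeff_eq_zero_of_natDegree_lt (p := f) (by omega), coeff_zero])
    rw [hj, h0, coeff_C_mul_X_pow] at hij
    have : i = a := by
      by_contra h
      exact hij (if_neg h)
    rw [this, one_mul, zero_mul, add_zero]
  · exact ⟨f.natDegree * a, f.natDegree, a - b, by exact_mod_cast hzero, fun i j hij ↦
      intCast_relation_lift hp' (by omega) hb (hd i j hij) (hcf i j hij) hca⟩

end Transfer

/-- Transfer of the main theorem to large positive characteristic: for every degree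
bound `d` there is `N_d` such that over any field `K` of prime characteristic `p > N_d`,
for every geometrically reduced bivariate polynomial `f = Σ_{i=0}^n f_i(x) y^i ∈ K[x][y]`
of total degree at most `d` with `f₀ ≠ 0` and `f_n ≠ 0`, quasi-homogeneity with nonzero
weight of `x` is equivalent to `f₀`, `f_n` being nonzero monomials and, for every
nonzero `a` in the algebraic closure `K̄`, the polynomial `f(a, y) ∈ K̄[y]` having
degree `n` and no repeated root in `K̄`. -/
theorem quasiHomogeneous_iff_large_char :
    ∀ d : ℕ, ∃ N : ℕ, ∀ (K : Type) [Field K], ∀ p : ℕ, p.Prime → CharP K p → N < p →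
      ∀ (f : Polynomial (Polynomial K)) (n : ℕ), n = f.natDegree →
        (∀ i j : ℕ, (f.coeff j).coeff i ≠ 0 → i + j ≤ d) →
        Squarefree (f.map (mapRingHom (algebraMap K (AlgebraicClosure K)))) →
        f.coeff 0 ≠ 0 → f.coeff n ≠ 0 →
        ((∃ w α β : ℤ, α ≠ 0 ∧
            ∀ i j : ℕ, (f.coeff j).coeff i ≠ 0 → α * (i : ℤ) + β * (j : ℤ) = w) ↔
          (IsNonzeroMonomial (f.coeff 0) ∧ IsNonzeroMonomial (f.coeff n) ∧
            ∀ a : AlgebraicClosure K, a ≠ 0 →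
              ((f.map (mapRingHom (algebraMap K (AlgebraicClosure K)))).map
                  (evalRingHom a)).natDegree = n ∧
                ∀ b : AlgebraicClosure K,
                  ((f.map (mapRingHom (algebraMap K (AlgebraicClosure K)))).map
                    (evalRingHom a)).rootMultiplicity b ≤ 1)) := by
  intro d
  refine ⟨d.factorial + 3 * d ^ 2, fun K _ p _ _ hp f n hn hd hsq h0 hfn ↦ ?_⟩
  subst hn
  have : CharP (AlgebraicClosure K) p :=
    charP_of_injective_algebraMap (algebraMap K (AlgebraicClosure K)).injective p
  constructor
  · rintro ⟨w, α, β, hα, hf⟩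
    exact fibres_of_quasiHomogeneous (p := p) (by omega) hd hsq h0 hfn hα hf
  · rintro ⟨h0, hn, hfib⟩
    exact quasiHomogeneous_of_fibres (p := p) (by omega) (by omega) hd hsq h0 hn
      fun a b ha ↦ (hfib a ha).2 b
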